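/- Let G be a finitely generated nilpotent group and P a positive cone of G. Then there exist a natural number n and a finite chain of subgroups {1} = C_{n+1} ⊆ C_n ⊆ … ⊆ C_0 = G such that for each i ∈ {0,…,n}: C_{i+1} is a normal subgroup of C_i, C_{i+1} is convex with respect to P, and there exists a group homomorphism f_i : C_i → ℝ with kernel exactly C_{i+1} which is nondecreasing with respect to P (for x, y ∈ C_i, x⁻¹y ∈ P implies f_i(x) ≤ f_i(y)). -/

import Mathlib

/-- A positive cone of a group `G`: a subsemigroup `P` such that `G` is the disjoint
union of `P`, `P⁻¹` and `{1}`. -/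
def IsPositiveCone {G : Type*} [Group G] (P : Set G) : Prop :=
  (∀ a ∈ P, ∀ b ∈ P, a * b ∈ P) ∧
  (∀ g : G, g ∈ P ∨ g⁻¹ ∈ P ∨ g = 1) ∧
  (∀ g ∈ P, g⁻¹ ∉ P) ∧
  (1 : G) ∉ P

/-- A subset `C` of a group is convex with respect to a positive cone `P` if any
element lying between two elements of `C` (for the order `x ≼ y ↔ x⁻¹ * y ∈ P ∪ {1}`)
belongs to `C`. -/
def IsConvexIn {G : Type*} [Group G] (P : Set G) (C : Set G) : Prop :=
  ∀ g ∈ C, ∀ h ∈ C, ∀ f : G,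
    (g⁻¹ * f ∈ P ∨ g⁻¹ * f = 1) → (f⁻¹ * h ∈ P ∨ f⁻¹ * h = 1) → f ∈ C

open scoped commutatorElement

section MaximalSubmonoid

variable {G : Type*} [Group G]

theorem Submonoid.isCoatomic_of_fg {M : Type*} [Monoid M] [Monoid.FG M] :
    IsCoatomic (Submonoid M) := by
  apply CompleteLattice.coatomic_of_top_compact
  rw [CompleteLattice.isCompactElement_iff_le_of_directed_sSup_le]
  intro s hs hdir hle
  obtain ⟨t, ht⟩ := Monoid.fg_def.1 ‹Monoid.FG M›
  have hsub : (t : Set M) ⊆ ⋃ S ∈ s, (S : Set M) := fun x _ => by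
    have hx : x ∈ sSup s := hle (Submonoid.mem_top x)
    rw [Submonoid.mem_sSup_of_directedOn hs hdir] at hx
    simpa using hx
  obtain ⟨S, hS, htS⟩ := DirectedOn.exists_mem_subset_of_finset_subset_biUnion hs
    (f := fun S : Submonoid M => (S : Set M)) hdir hsub
  exact ⟨S, hS, ht ▸ Submonoid.closure_le.2 htS⟩

theorem pow_mul_pow_of_mul_eq {a b c : G} (hc : c ∈ Subgroup.center G)
    (hab : a * b = c * b * a) (m n : ℕ) : a ^ m * b ^ n = c ^ (m * n) * b ^ n * a ^ m := by
  have hcomm : ∀ g, Commute c g := fun g => (Subgroup.mem_center_iff.1 hc g).symm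
  have h : a * b ^ n = c ^ n * b ^ n * a := by
    have := SemiconjBy.pow_right (show SemiconjBy a b (c * b) from hab) n
    rwa [(hcomm b).mul_pow] at this
  induction m with
  | zero => simp
  | succ m ih =>
    rw [pow_succ, mul_assoc, h, ← mul_assoc, ← mul_assoc,
      ← ((hcomm (a ^ m)).pow_left n).eq, mul_assoc (c ^ n), ih, ← mul_assoc, ← mul_assoc,
      ← pow_add, mul_assoc _ (a ^ m) a]
    congr 3
    ring

theorem Group.mul_comm_of_isNilpotent [Group.IsNilpotent G]
    (h : ∀ a b c : G, c ∈ Subgroup.center G → a * b = c * b * a → c = 1) (a b : G) :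
    a * b = b * a := by
  have hle : ∀ n, Subgroup.upperCentralSeries G n ≤ Subgroup.center G := fun n => by
    induction n with
    | zero => simp
    | succ n ih =>
      intro x hx
      refine Subgroup.mem_center_iff.2 fun y => ?_
      have hc := ih (Subgroup.mem_upperCentralSeries_succ_iff.1 hx y)
      exact (mul_inv_eq_one.1 (by simpa [mul_assoc] using h x y (x * y * x⁻¹ * y⁻¹) hc (by simp))).symm
  obtain ⟨n, hn⟩ := Group.IsNilpotent.nilpotent G
  have hb : b ∈ Subgroup.center G := hle n (hn ▸ Subgroup.mem_top b)
  exact Subgroup.mem_center_iff.1 hb a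

namespace Submonoid

theorem exists_pow_mul_mem_of_isCoatom {S : Submonoid G} (hS : IsCoatom S) {z : G}
    (hz : z ∈ Subgroup.center G) (hzS : z⁻¹ ∉ S) (g : G) : ∃ n : ℕ, z ^ n * g ∈ S := by
  have hc : ∀ (n : ℕ) (g : G), Commute (z ^ n) g := fun n g =>
    Commute.pow_left (Subgroup.mem_center_iff.1 hz g).symm n
  let T : Submonoid G :=
    { carrier := {g | ∃ n : ℕ, z ^ n * g ∈ S}
      one_mem' := ⟨0, by simp⟩
      mul_mem' := by
        rintro a b ⟨m, hm⟩ ⟨n, hn⟩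
        refine ⟨m + n, ?_⟩
        have h : z ^ (m + n) * (a * b) = z ^ m * a * (z ^ n * b) := by
          rw [pow_add, mul_assoc, ← mul_assoc _ a b, (hc n a).eq]
          simp only [mul_assoc]
        rw [h]
        exact S.mul_mem hm hn }
  have hST : S < T := lt_of_le_of_ne (fun s hs => ⟨0, by simpa using hs⟩) fun h =>
    hzS (h ▸ (⟨1, by simp⟩ : z⁻¹ ∈ T))
  have hg : g ∈ T := hS.2 T hST ▸ mem_top g
  exact hg

theorem inv_mem_of_isCoatom_of_mul_eq {S : Submonoid G} (hS : IsCoatom S)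
    (htot : ∀ g, g ∈ S ∨ g⁻¹ ∈ S) {a b c : G} (hc : c ∈ Subgroup.center G)
    (hab : a * b = c * b * a) : c⁻¹ ∈ S := by
  by_contra hcS
  have hcomm : ∀ g, Commute c g := fun g => (Subgroup.mem_center_iff.1 hc g).symm
  have hcS' : c ∈ S := (htot c).resolve_right hcS
  have hlarge : ∀ g, ∃ n : ℕ, ∀ m, n ≤ m → c ^ m * g ∈ S := fun g => by
    obtain ⟨n, hn⟩ := exists_pow_mul_mem_of_isCoatom hS hc hcS g
    refine ⟨n, fun m hm => ?_⟩
    obtain ⟨d, rfl⟩ := Nat.exists_eq_add_of_le hm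
    rw [add_comm, pow_add, mul_assoc]
    exact S.mul_mem (S.pow_mem hcS' d) hn
  obtain ⟨k₁, h₁⟩ := hlarge a
  obtain ⟨k₂, h₂⟩ := hlarge a⁻¹
  obtain ⟨k₃, h₃⟩ := hlarge b
  obtain ⟨k₄, h₄⟩ := hlarge b⁻¹
  set k := k₁ + k₂ + k₃ + k₄
  set n := 4 * k + 1 with hn
  have hmem : (c ^ k * b) ^ n * (c ^ k * a) ^ n * (c ^ k * b⁻¹) ^ n * (c ^ k * a⁻¹) ^ n ∈ S :=
    S.mul_mem (S.mul_mem (S.mul_mem (S.pow_mem (h₃ k (by omega)) n)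
      (S.pow_mem (h₁ k (by omega)) n)) (S.pow_mem (h₄ k (by omega)) n))
      (S.pow_mem (h₂ k (by omega)) n)
  simp only [((hcomm _).pow_left k).mul_pow, ← pow_mul, inv_pow] at hmem
  have hu : ∀ x y, x * (c ^ (k * n) * y) = c ^ (k * n) * (x * y) := fun x y => by
    rw [← mul_assoc, ← ((hcomm x).pow_left (k * n)).eq, mul_assoc]
  have hinv : c ^ (n * n) * (b ^ n * a ^ n * (b ^ n)⁻¹ * (a ^ n)⁻¹) = 1 := by
    have h := pow_mul_pow_of_mul_eq hc hab n n
    rw [← mul_assoc, ← mul_assoc, ← mul_assoc, ← h]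
    group
  have hp : c ^ (n * n) * (c ^ (k * n) * b ^ n * (c ^ (k * n) * a ^ n) *
      (c ^ (k * n) * (b ^ n)⁻¹) * (c ^ (k * n) * (a ^ n)⁻¹)) = c ^ (4 * k * n) := by
    simp only [mul_assoc, hu]
    simp only [mul_assoc] at hinv
    rw [eq_inv_of_mul_eq_one_right hinv]
    simp only [← mul_assoc, ← pow_add]
    rw [mul_inv_eq_iff_eq_mul, ← pow_add]
    congr 1
    ring
  refine hcS ?_
  have hfinal := S.mul_mem (S.pow_mem hcS' (4 * k)) hmem
  convert hfinal using 1
  rw [show n * n = 4 * k * n + (1 + 4 * k) by rw [hn]; ring, pow_add, pow_add, pow_one,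
    mul_assoc, mul_assoc] at hp
  exact inv_eq_of_mul_eq_one_right (by rw [← mul_assoc]; exact mul_eq_left.1 hp)

theorem exists_monoidHom_real_of_isCoatom_of_core_eq_bot [Group.IsNilpotent G]
    {S : Submonoid G} (hS : IsCoatom S) (htot : ∀ g, g ∈ S ∨ g⁻¹ ∈ S)
    (hcore : ∀ N : Subgroup G, N.Normal → (∀ g ∈ N, g ∈ S) → N = ⊥) :
    ∃ f : G →* Multiplicative ℝ, (∀ g ∈ S, 1 ≤ f g) ∧ ∃ g, f g ≠ 1 := by
  have hcomm : ∀ a b : G, a * b = b * a := by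
    refine Group.mul_comm_of_isNilpotent fun a b c hc hab => ?_
    have hinv : c⁻¹ ∈ S := inv_mem_of_isCoatom_of_mul_eq hS htot hc hab
    have hmem : c ∈ S := by
      have := inv_mem_of_isCoatom_of_mul_eq hS htot (a := b) (b := a) (inv_mem hc)
        (by rw [mul_assoc, hab]; group)
      rwa [inv_inv] at this
    have hbot := hcore (Subgroup.zpowers c)
      ⟨fun x hx g => by
        rw [Subgroup.mem_center_iff.1 (Subgroup.zpowers_le.2 hc hx) g, mul_inv_cancel_right]
        exact hx⟩ ?_
    · exact Subgroup.zpowers_eq_bot.1 hbot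
    · rintro _ ⟨n, rfl⟩
      cases n with
      | ofNat n => simpa using S.pow_mem hmem n
      | negSucc n => simpa [zpow_negSucc] using S.pow_mem hinv (n + 1)
  have hanti : ∀ g, g ∈ S → g⁻¹ ∈ S → g = 1 := fun g h₁ h₂ => by
    have hbot := hcore (Subgroup.zpowers g)
      ⟨fun x hx y => by rw [hcomm y x, mul_inv_cancel_right]; exact hx⟩ ?_
    · exact Subgroup.zpowers_eq_bot.1 hbot
    · rintro _ ⟨n, rfl⟩
      cases n with
      | ofNat n => simpa using S.pow_mem h₁ n
      | negSucc n => simpa [zpow_negSucc] using S.pow_mem h₂ (n + 1)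
  classical
  let _ : CommGroup G := { ‹Group G› with mul_comm := hcomm }
  let _ : LinearOrder G :=
    { le := fun x y => x⁻¹ * y ∈ S
      le_refl := fun x => by simp
      le_trans := fun x y z hxy hyz => by simpa [mul_assoc] using S.mul_mem hxy hyz
      le_antisymm := fun x y hxy hyx =>
        inv_mul_eq_one.1 (hanti _ hxy (by simpa [mul_inv_rev] using hyx))
      le_total := fun x y => by simpa [mul_inv_rev] using htot (x⁻¹ * y)
      toDecidableLE := Classical.decRel _ }
  have hle : ∀ x y : G, x ≤ y ↔ x⁻¹ * y ∈ S := fun _ _ => Iff.rfl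
  have : IsOrderedMonoid G :=
    { mul_le_mul_left := fun x y hxy z => by
        rw [hle] at hxy ⊢
        rwa [mul_inv, mul_mul_mul_comm, inv_mul_cancel, mul_one] }
  have : MulArchimedean G :=
    ⟨fun x y hy => by
      obtain ⟨n, hn⟩ := exists_pow_mul_mem_of_isCoatom hS (z := y)
        (Subgroup.mem_center_iff.2 fun g => hcomm g y)
        (fun h => hy.not_ge ((hle y 1).2 (by simpa using h))) x⁻¹
      exact ⟨n, (hle _ _).2 (by rwa [hcomm])⟩⟩
  obtain ⟨φ, hφ⟩ := Archimedean.exists_orderAddMonoidHom_real_injective (Additive G)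
  refine ⟨AddMonoidHom.toMultiplicativeRight φ.toAddMonoidHom, fun g hg => ?_, ?_⟩
  · have : (0 : Additive G) ≤ Additive.ofMul g := (hle 1 g).2 (by simpa using hg)
    have h := φ.monotone' this
    rw [ZeroHom.toFun_eq_coe, AddMonoidHom.toZeroHom_coe, map_zero] at h
    exact h
  · obtain ⟨g, hg⟩ : ∃ g, g ∉ S := by
      by_contra! h
      exact hS.1 (eq_top_iff.2 fun g _ => h g)
    refine ⟨g, fun h => hg ?_⟩
    have h1 : Additive.ofMul g = 0 := hφ (by rw [map_zero]; exact h)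
    rw [ofMul_eq_zero.1 h1]
    exact S.one_mem

theorem exists_monoidHom_real_of_isCoatom [Group.IsNilpotent G]
    {S : Submonoid G} (hS : IsCoatom S) (htot : ∀ g, g ∈ S ∨ g⁻¹ ∈ S) :
    ∃ f : G →* Multiplicative ℝ, (∀ g ∈ S, 1 ≤ f g) ∧ ∃ g, f g ≠ 1 := by
  let H : Subgroup G :=
    { carrier := {g | g ∈ S ∧ g⁻¹ ∈ S}
      one_mem' := by simp
      mul_mem' := fun ha hb =>
        ⟨S.mul_mem ha.1 hb.1, by rw [mul_inv_rev]; exact S.mul_mem hb.2 ha.2⟩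
      inv_mem' := fun ha => ⟨ha.2, by rw [inv_inv]; exact ha.1⟩ }
  let N := H.normalCore
  let π := QuotientGroup.mk' N
  have hπ : Function.Surjective π := QuotientGroup.mk'_surjective N
  have hSπ : ∀ g, π g ∈ S.map π ↔ g ∈ S := fun g => by
    refine ⟨?_, mem_map_of_mem π⟩
    rintro ⟨s, hs, hsg⟩
    have h : s⁻¹ * g ∈ N := QuotientGroup.eq.1 hsg
    simpa using S.mul_mem hs (H.normalCore_le h).1
  have hcoatom : IsCoatom (S.map π) := by
    refine ⟨fun h => hS.1 (eq_top_iff.2 fun g _ => (hSπ g).1 (h ▸ mem_top _)), fun T hT => ?_⟩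
    have hST : S < T.comap π := by
      refine lt_of_le_of_ne (map_le_iff_le_comap.1 hT.le) fun h => hT.ne ?_
      rw [h, map_comap_eq_of_surjective hπ]
    rw [← map_comap_eq_of_surjective hπ T, hS.2 _ hST, ← MonoidHom.mrange_eq_map,
      MonoidHom.mrange_eq_top.2 hπ]
  obtain ⟨f, hf, q, hq⟩ := exists_monoidHom_real_of_isCoatom_of_core_eq_bot hcoatom
    (fun q => by
      obtain ⟨g, rfl⟩ := hπ q
      rw [← map_inv, hSπ, hSπ]
      exact htot g)
    (fun M hM hMS => by
      have hle : M.comap π ≤ N := by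
        rw [Subgroup.normal_le_normalCore]
        exact fun g hg => ⟨(hSπ g).1 (hMS _ hg),
          (hSπ g⁻¹).1 (hMS _ (by rw [map_inv]; exact inv_mem hg))⟩
      refine eq_bot_iff.2 fun q hq => ?_
      obtain ⟨g, rfl⟩ := hπ q
      exact (QuotientGroup.eq_one_iff g).2 (hle hq))
  obtain ⟨g, rfl⟩ := hπ q
  exact ⟨f.comp π, fun s hs => hf _ (mem_map_of_mem π hs), g, hq⟩

end Submonoid

end MaximalSubmonoid

section PolycyclicLength

variable {G : Type*} [Group G]

/-- `HasPolycyclicLength k H` says that `H` has a subnormal series of length `k` with cyclic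
factors. -/
inductive HasPolycyclicLength : ℕ → Subgroup G → Prop
  | bot : HasPolycyclicLength 0 ⊥
  | step {k : ℕ} {N H : Subgroup G} (x : G) (hN : HasPolycyclicLength k N) (hNH : N ≤ H)
      (hx : x ∈ H) (hnormal : ∀ h ∈ H, ∀ n ∈ N, h * n * h⁻¹ ∈ N)
      (hgen : ∀ h ∈ H, ∃ m : ℤ, x ^ m * h ∈ N) : HasPolycyclicLength (k + 1) H

namespace HasPolycyclicLength

theorem fg {k : ℕ} {H : Subgroup G} (h : HasPolycyclicLength k H) : H.FG := by
  induction h with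
  | bot => exact Subgroup.FG.bot
  | @step k N H x _ hNH hx _ hgen ih =>
    have hH : H = N ⊔ Subgroup.zpowers x := by
      refine le_antisymm (fun h hh => ?_) (sup_le hNH (Subgroup.zpowers_le.2 hx))
      obtain ⟨m, hm⟩ := hgen h hh
      have : h = x ^ (-m) * (x ^ m * h) := by group
      rw [this]
      exact mul_mem (Subgroup.mem_sup_right (Subgroup.zpow_mem_zpowers x _))
        (Subgroup.mem_sup_left hm)
    rw [hH]
    refine ih.sup ⟨{x}, ?_⟩
    rw [Finset.coe_singleton, ← Subgroup.zpowers_eq_closure]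

theorem of_inf {k : ℕ} {N H L : Subgroup G} {x : G} (hLN : HasPolycyclicLength k (L ⊓ N))
    (hLH : L ≤ H) (hnormal : ∀ h ∈ H, ∀ n ∈ N, h * n * h⁻¹ ∈ N) (hx : x ∈ H)
    (hgen : ∀ h ∈ H, ∃ m : ℤ, x ^ m * h ∈ N) : HasPolycyclicLength (k + 1) L := by
  let A : AddSubgroup ℤ :=
    { carrier := {m | ∃ h ∈ L, x ^ m * h ∈ N}
      zero_mem' := ⟨1, L.one_mem, by simp⟩
      add_mem' := by
        rintro m n ⟨g, hg, hgN⟩ ⟨h, hh, hhN⟩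
        refine ⟨h * g, L.mul_mem hh hg, ?_⟩
        have h₁ := hnormal _ (H.zpow_mem hx m) _ hhN
        have h₂ : x ^ (m + n) * (h * g) = x ^ m * (x ^ n * h) * (x ^ m)⁻¹ * (x ^ m * g) := by
          group
        rw [h₂]
        exact N.mul_mem h₁ hgN
      neg_mem' := by
        rintro m ⟨g, hg, hgN⟩
        refine ⟨g⁻¹, L.inv_mem hg, ?_⟩
        have h₁ := hnormal _ (hLH hg) _ (N.inv_mem hgN)
        rwa [mul_inv_rev, mul_assoc, mul_assoc, mul_inv_cancel_left, ← zpow_neg] at h₁ }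
  obtain ⟨d, hd⟩ := Int.subgroup_cyclic A
  obtain ⟨y, hy, hyN⟩ : d ∈ A := hd ▸ AddSubgroup.mem_closure_singleton_self d
  refine step y hLN inf_le_left hy (fun h hh n hn => ⟨L.mul_mem (L.mul_mem hh hn.1) (L.inv_mem hh),
    hnormal h (hLH hh) n hn.2⟩) fun h hh => ?_
  obtain ⟨m, hm⟩ := hgen h (hLH hh)
  have hmA : m ∈ A := ⟨h, hh, hm⟩
  rw [hd, AddSubgroup.mem_closure_singleton] at hmA
  obtain ⟨e, rfl⟩ := hmA
  refine ⟨-e, L.mul_mem (L.zpow_mem hy _) hh, ?_⟩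
  have : (N.subgroupOf H).Normal := ⟨fun n hn g => hnormal g g.2 n hn⟩
  have hπ : ∀ g : H, (g : G) ∈ N ↔ QuotientGroup.mk' (N.subgroupOf H) g = 1 := fun g =>
    Subgroup.mem_subgroupOf.symm.trans (QuotientGroup.eq_one_iff g).symm
  have h₁ := (hπ (⟨x, hx⟩ ^ d * ⟨y, hLH hy⟩)).1 hyN
  have h₂ := (hπ (⟨x, hx⟩ ^ (e • d) * ⟨h, hLH hh⟩)).1 hm
  refine (hπ (⟨y, hLH hy⟩ ^ (-e) * ⟨h, hLH hh⟩)).2 ?_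
  rw [map_mul, map_zpow] at h₁ h₂ ⊢
  rw [← inv_eq_of_mul_eq_one_right h₁, ← inv_eq_of_mul_eq_one_right h₂, smul_eq_mul]
  rw [zpow_neg, inv_zpow, inv_inv, ← zpow_mul, mul_comm d e, mul_inv_cancel]

theorem exists_lt_inf_ker {k : ℕ} {H : Subgroup G} (h : HasPolycyclicLength k H)
    {f : G → ℝ} (hf : ∀ x ∈ H, ∀ y ∈ H, f (x * y) = f x + f y) (hne : ∃ x ∈ H, f x ≠ 0)
    (K : Subgroup G) (hK : ∀ x, x ∈ K ↔ x ∈ H ∧ f x = 0) :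
    ∃ j < k, HasPolycyclicLength j K := by
  induction h generalizing K with
  | bot =>
    obtain ⟨x, hx, hfx⟩ := hne
    have h1 := hf 1 (one_mem _) 1 (one_mem _)
    rw [mul_one] at h1
    rw [Subgroup.mem_bot.1 hx] at hfx
    exact absurd (by linarith) hfx
  | @step k N H x hN hNH hx hnormal hgen ih =>
    by_cases hfN : ∃ y ∈ N, f y ≠ 0
    · obtain ⟨j, hj, hjK⟩ := ih (fun a ha b hb => hf a (hNH ha) b (hNH hb)) hfN (K ⊓ N)
        fun y => ⟨fun hy => ⟨hy.2, ((hK y).1 hy.1).2⟩,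
          fun hy => ⟨(hK y).2 ⟨hNH hy.1, hy.2⟩, hy.1⟩⟩
      exact ⟨j + 1, by omega, of_inf hjK (fun y hy => ((hK y).1 hy).1) hnormal hx hgen⟩
    · push Not at hfN
      refine ⟨k, by omega, ?_⟩
      let φ : H →* Multiplicative ℝ := MonoidHom.mk' (fun y => Multiplicative.ofAdd (f y))
        fun a b => congrArg Multiplicative.ofAdd (hf a a.2 b b.2)
      have hfpow : ∀ m : ℤ, f (x ^ m) = m * f x := fun m => by
        have := congrArg Multiplicative.toAdd (map_zpow φ ⟨x, hx⟩ m)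
        simpa [φ] using this
      have hadd : ∀ h ∈ H, ∃ m : ℤ, x ^ m * h ∈ N ∧ m * f x + f h = 0 := fun h hh => by
        obtain ⟨m, hm⟩ := hgen h hh
        exact ⟨m, hm, by rw [← hfpow, ← hf _ (H.zpow_mem hx m) _ hh, hfN _ hm]⟩
      have hfx : f x ≠ 0 := fun h0 => by
        obtain ⟨y, hy, hfy⟩ := hne
        obtain ⟨m, -, hm⟩ := hadd y hy
        exact hfy (by simpa [h0] using hm)
      have hKN : K = N := by
        ext y
        refine ⟨fun hy => ?_, fun hy => (hK y).2 ⟨hNH hy, hfN y hy⟩⟩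
        obtain ⟨hyH, hfy⟩ := (hK y).1 hy
        obtain ⟨m, hmN, hm⟩ := hadd y hyH
        have hm0 : m = 0 := by simpa [hfy, hfx] using hm
        simpa [hm0] using hmN
      rwa [hKN]

theorem exists_of_closure_sup {A B : Subgroup G} {k : ℕ} (hA : HasPolycyclicLength k A)
    (hAB : A ≤ B) (hcomm : ⁅B, (⊤ : Subgroup G)⁆ ≤ A) (T : Finset G) (hT : (T : Set G) ⊆ B) :
    ∃ j, HasPolycyclicLength j (Subgroup.closure (T : Set G) ⊔ A) := by
  classical
  induction T using Finset.induction_on with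
  | empty => exact ⟨k, by simpa using hA⟩
  | insert t T _ ih =>
    rw [Finset.coe_insert, Set.insert_subset_iff] at hT
    obtain ⟨j, hj⟩ := ih hT.2
    have hle : Subgroup.closure (T : Set G) ⊔ A ≤ B :=
      sup_le ((Subgroup.closure_le B).2 hT.2) hAB
    set N := Subgroup.closure (T : Set G) ⊔ A
    have hN : N.Normal := ⟨fun n hn g => by
      have h : ⁅n, g⁆ ∈ A := hcomm (Subgroup.commutator_mem_commutator (hle hn) (Subgroup.mem_top g))
      have h' : g * n * g⁻¹ = ⁅n, g⁆⁻¹ * n := by rw [commutatorElement_def]; group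
      rw [h']
      exact N.mul_mem (N.inv_mem (Subgroup.mem_sup_right h)) hn⟩
    have heq : Subgroup.closure (↑(insert t T) : Set G) ⊔ A = Subgroup.zpowers t ⊔ N := by
      rw [Finset.coe_insert, Set.insert_eq, Subgroup.closure_union, sup_assoc,
        Subgroup.zpowers_eq_closure]
    refine ⟨j + 1, ?_⟩
    rw [heq]
    refine step t hj le_sup_right (Subgroup.mem_sup_left (Subgroup.mem_zpowers t))
      (fun h _ n hn => hN.conj_mem n hn h) fun h hh => ?_
    obtain ⟨_, ⟨m, rfl⟩, n, hn, rfl⟩ := Subgroup.mem_sup_of_normal_right.1 hh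
    exact ⟨-m, by simpa using hn⟩

end HasPolycyclicLength

theorem Subgroup.exists_finset_lowerCentralSeries_le [Group.FG G] (i : ℕ) :
    ∃ T : Finset G, (T : Set G) ⊆ (⊤ : Subgroup G).lowerCentralSeries i ∧
      (⊤ : Subgroup G).lowerCentralSeries i ≤
        closure (T : Set G) ⊔ (⊤ : Subgroup G).lowerCentralSeries (i + 1) := by
  classical
  obtain ⟨Y, hY⟩ := Group.fg_def.1 ‹Group.FG G›
  set Γ := (⊤ : Subgroup G).lowerCentralSeries
  have hmem : ∀ (i : ℕ) (a g : G), a ∈ Γ i → ⁅a, g⁆ ∈ Γ (i + 1) := fun i a g ha =>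
    commutator_mem_commutator ha (mem_top g)
  induction i with
  | zero => exact ⟨Y, fun _ _ => mem_top _, by rw [hY]; exact le_sup_of_le_left le_top⟩
  | succ i ih =>
    obtain ⟨T, hT, hTΓ⟩ := ih
    let U : Finset G := (T ×ˢ Y).image fun p => ⁅p.1, p.2⁆
    have hU : (U : Set G) ⊆ Γ (i + 1) := by
      intro u hu
      obtain ⟨⟨t, y⟩, hp, rfl⟩ := Finset.mem_image.1 (Finset.mem_coe.1 hu)
      exact hmem i t y (hT (Finset.mem_product.1 hp).1)
    refine ⟨U, hU, ?_⟩
    set D := closure (U : Set G) ⊔ Γ (i + 2)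
    have hle : D ≤ Γ (i + 1) :=
      sup_le ((closure_le _).2 hU) (lowerCentralSeries_antitone _ (Nat.le_succ _))
    have hD : D.Normal := ⟨fun n hn g => by
      have h' : g * n * g⁻¹ = ⁅n, g⁆⁻¹ * n := by rw [commutatorElement_def]; group
      rw [h']
      exact D.mul_mem (D.inv_mem (mem_sup_right (hmem _ n g (hle hn)))) hn⟩
    let π := QuotientGroup.mk' D
    have hπ : ∀ g, π g = 1 ↔ g ∈ D := QuotientGroup.eq_one_iff
    have hcenter : Γ i ≤ (center (G ⧸ D)).comap π := by
      refine hTΓ.trans (sup_le ((closure_le _).2 fun t ht => ?_) fun c hc => ?_)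
      · have htop : (⊤ : Subgroup G) ≤ (centralizer {π t}).comap π := by
          rw [← hY, closure_le]
          intro y hy
          have h : ⁅t, y⁆ ∈ D := mem_sup_left (subset_closure
            (Finset.mem_coe.2 (Finset.mem_image_of_mem _ (Finset.mk_mem_product ht hy))))
          rw [← hπ, map_commutatorElement, commutatorElement_eq_one_iff_mul_comm] at h
          exact mem_centralizer_singleton_iff.2 h.symm
        refine mem_center_iff.2 fun q => ?_
        obtain ⟨g, rfl⟩ := QuotientGroup.mk'_surjective D q
        exact mem_centralizer_singleton_iff.1 (htop (mem_top g))
      · refine mem_center_iff.2 fun q => ?_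
        obtain ⟨g, rfl⟩ := QuotientGroup.mk'_surjective D q
        have h : ⁅c, g⁆ ∈ D := mem_sup_right (hmem _ c g hc)
        rw [← hπ, map_commutatorElement, commutatorElement_eq_one_iff_mul_comm] at h
        exact h.symm
    refine commutator_le.2 fun a ha g _ => ?_
    rw [← hπ, map_commutatorElement, commutatorElement_eq_one_iff_mul_comm]
    exact (mem_center_iff.1 (hcenter ha) (π g)).symm

theorem exists_hasPolycyclicLength_top [Group.FG G] [Group.IsNilpotent G] :
    ∃ k, HasPolycyclicLength k (⊤ : Subgroup G) := by
  obtain ⟨n, hn⟩ := Subgroup.nilpotent_iff_lowerCentralSeries.1 ‹Group.IsNilpotent G›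
  refine Nat.decreasingInduction
    (motive := fun i _ => ∃ k, HasPolycyclicLength k ((⊤ : Subgroup G).lowerCentralSeries i))
    (fun i _ ⟨k, hk⟩ => ?_) ⟨0, hn ▸ .bot⟩ (Nat.zero_le n)
  have hanti := Subgroup.lowerCentralSeries_antitone (⊤ : Subgroup G) (Nat.le_succ i)
  obtain ⟨T, hT, hTle⟩ := Subgroup.exists_finset_lowerCentralSeries_le (G := G) i
  obtain ⟨j, hj⟩ := hk.exists_of_closure_sup hanti le_rfl T hT
  exact ⟨j, (le_antisymm hTle (sup_le ((Subgroup.closure_le _).2 hT) hanti)) ▸ hj⟩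

end PolycyclicLength

namespace IsPositiveCone

variable {G : Type*} [Group G] {P : Set G}

theorem comap_subtype (hP : IsPositiveCone P) (H : Subgroup G) :
    IsPositiveCone {h : H | (h : G) ∈ P} := by
  obtain ⟨hmul, htri, hinv, hone⟩ := hP
  refine ⟨fun a ha b hb => hmul a ha b hb, fun g => ?_, fun g hg => hinv g hg, hone⟩
  rcases htri g with h | h | h
  · exact Or.inl h
  · exact Or.inr (Or.inl h)
  · exact Or.inr (Or.inr (Subtype.ext h))

theorem exists_monoidHom_real [Group.FG G] [Group.IsNilpotent G] [Nontrivial G]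
    (hP : IsPositiveCone P) :
    ∃ f : G →* Multiplicative ℝ, (∀ g ∈ P, 1 ≤ f g) ∧ ∃ g, f g ≠ 1 := by
  obtain ⟨hmul, htri, hinv, -⟩ := hP
  let S₀ : Submonoid G :=
    { carrier := {g | g = 1 ∨ g ∈ P}
      one_mem' := Or.inl rfl
      mul_mem' := by
        rintro a b (rfl | ha) (rfl | hb)
        · exact Or.inl (one_mul 1)
        · exact Or.inr (by rwa [one_mul])
        · exact Or.inr (by rwa [mul_one])
        · exact Or.inr (hmul a ha b hb) }
  have hS₀ : S₀ ≠ ⊤ := fun h => by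
    have hmem : ∀ g ≠ 1, g ∈ P := fun g hg =>
      (show g ∈ S₀ from h ▸ Submonoid.mem_top g).resolve_left hg
    obtain ⟨g, hg⟩ := exists_ne (1 : G)
    exact hinv g (hmem g hg) (hmem g⁻¹ (inv_ne_one.2 hg))
  have := Submonoid.isCoatomic_of_fg (M := G)
  obtain ⟨S, hS, hle⟩ := (eq_top_or_exists_le_coatom S₀).resolve_left hS₀
  obtain ⟨f, hf, hne⟩ := Submonoid.exists_monoidHom_real_of_isCoatom hS fun g => by
    rcases htri g with h | h | rfl
    · exact Or.inl (hle (Or.inr h))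
    · exact Or.inr (hle (Or.inr h))
    · exact Or.inl S.one_mem
  exact ⟨f, fun g hg => hf g (hle (Or.inr hg)), hne⟩

theorem exists_additive_on [Group.IsNilpotent G] (hP : IsPositiveCone P) {H : Subgroup G}
    (hfg : H.FG) (hH : H ≠ ⊥) :
    ∃ f : G → ℝ, (∀ x ∈ H, ∀ y ∈ H, f (x * y) = f x + f y) ∧
      (∀ x ∈ H, x ∈ P → 0 ≤ f x) ∧ ∃ x ∈ H, f x ≠ 0 := by
  classical
  have : Group.FG H := (Group.fg_iff_subgroup_fg H).2 hfg
  have : Nontrivial H := (Subgroup.nontrivial_iff_ne_bot H).2 hH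
  obtain ⟨φ, hφ, x, hx⟩ := (hP.comap_subtype H).exists_monoidHom_real
  let f : G → ℝ := fun g => if h : g ∈ H then Multiplicative.toAdd (φ ⟨g, h⟩) else 0
  have hf : ∀ g (h : g ∈ H), f g = Multiplicative.toAdd (φ ⟨g, h⟩) := fun g h => dif_pos h
  refine ⟨f, fun a ha b hb => ?_, fun a ha haP => ?_, x, x.2, fun h => hx ?_⟩
  · rw [hf _ (H.mul_mem ha hb), hf a ha, hf b hb, ← toAdd_mul, ← map_mul]
    rfl
  · rw [hf a ha]
    exact hφ ⟨a, ha⟩ haP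
  · rw [hf x x.2] at h
    exact h

theorem exists_convex_series [Group.IsNilpotent G] (hP : IsPositiveCone P) {k : ℕ}
    {H : Subgroup G} (hH : HasPolycyclicLength k H) (hconv : IsConvexIn P (H : Set G)) :
    ∃ (n : ℕ) (C : ℕ → Subgroup G),
      C 0 = H ∧ C (n + 1) = ⊥ ∧
      ∀ i ≤ n,
        C (i + 1) ≤ C i ∧
        (∀ x ∈ C i, ∀ y ∈ C (i + 1), x⁻¹ * y * x ∈ C (i + 1)) ∧
        IsConvexIn P (C (i + 1) : Set G) ∧
        ∃ f : G → ℝ,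
          (∀ x ∈ C i, ∀ y ∈ C i, f (x * y) = f x + f y) ∧
          (∀ x ∈ C i, (f x = 0 ↔ x ∈ C (i + 1))) ∧
          (∀ x ∈ C i, ∀ y ∈ C i, x⁻¹ * y ∈ P → f x ≤ f y) := by
  induction k using Nat.strong_induction_on generalizing H with
  | _ k ih =>
    by_cases hbot : H = ⊥
    · refine ⟨0, fun _ => ⊥, hbot.symm, rfl, fun i _ => ⟨le_rfl, fun x _ y hy => ?_,
        hbot ▸ hconv, fun _ => 0, by simp, fun x hx => by simpa using hx, by simp⟩⟩
      rw [Subgroup.mem_bot.1 hy]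
      simp
    · obtain ⟨f, hadd, hpos, hne⟩ := hP.exists_additive_on hH.fg hbot
      have hone : f 1 = 0 := by
        have h := hadd 1 H.one_mem 1 H.one_mem
        rw [mul_one] at h
        linarith
      have hneg : ∀ x ∈ H, f x⁻¹ = - f x := fun x hx => by
        have h := hadd x hx x⁻¹ (H.inv_mem hx)
        rw [mul_inv_cancel, hone] at h
        linarith
      have hmono : ∀ x ∈ H, ∀ y ∈ H, x⁻¹ * y ∈ P → f x ≤ f y := fun x hx y hy hxy => by
        have h := hpos _ (H.mul_mem (H.inv_mem hx) hy) hxy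
        rw [hadd _ (H.inv_mem hx) _ hy, hneg x hx] at h
        linarith
      have hmono' : ∀ x ∈ H, ∀ y ∈ H, x⁻¹ * y ∈ P ∨ x⁻¹ * y = 1 → f x ≤ f y := by
        rintro x hx y hy (h | h)
        · exact hmono x hx y hy h
        · rw [inv_mul_eq_one.1 h]
      let K : Subgroup G :=
        { carrier := {x | x ∈ H ∧ f x = 0}
          one_mem' := ⟨H.one_mem, hone⟩
          mul_mem' := fun {a b} ha hb => ⟨H.mul_mem ha.1 hb.1, by
            rw [hadd a ha.1 b hb.1, ha.2, hb.2, add_zero]⟩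
          inv_mem' := fun {a} ha => ⟨H.inv_mem ha.1, by rw [hneg a ha.1, ha.2, neg_zero]⟩ }
      obtain ⟨j, hj, hK⟩ := hH.exists_lt_inf_ker hadd hne K fun _ => Iff.rfl
      have hKconv : IsConvexIn P (K : Set G) := fun a ha b hb x hax hxb => by
        have hx : x ∈ H := hconv a ha.1 b hb.1 x hax hxb
        exact ⟨hx, le_antisymm ((hmono' x hx b hb.1 hxb).trans_eq hb.2)
          (ha.2.symm.trans_le (hmono' a ha.1 x hx hax))⟩
      obtain ⟨n, C, h0, hn, hC⟩ := ih j hj hK hKconv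
      refine ⟨n + 1, fun i => Nat.casesOn i H C, rfl, hn, fun i hi => ?_⟩
      cases i with
      | zero =>
        change C 0 ≤ H ∧ (∀ x ∈ H, ∀ y ∈ C 0, x⁻¹ * y * x ∈ C 0) ∧ IsConvexIn P (C 0 : Set G) ∧
          ∃ f : G → ℝ, (∀ x ∈ H, ∀ y ∈ H, f (x * y) = f x + f y) ∧
            (∀ x ∈ H, (f x = 0 ↔ x ∈ C 0)) ∧ (∀ x ∈ H, ∀ y ∈ H, x⁻¹ * y ∈ P → f x ≤ f y)
        rw [h0]
        refine ⟨fun x hx => hx.1, fun x hx y hy => ?_, hKconv, f, hadd,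
          fun x hx => ⟨fun h => ⟨hx, h⟩, fun h => h.2⟩, hmono⟩
        have hxy := H.mul_mem (H.inv_mem hx) hy.1
        refine ⟨H.mul_mem hxy hx, ?_⟩
        rw [hadd _ hxy _ hx, hadd _ (H.inv_mem hx) _ hy.1, hneg x hx, hy.2]
        ring
      | succ i => exact hC i (Nat.le_of_succ_le_succ hi)

end IsPositiveCone

/-- For every positive cone `P` of a finitely generated nilpotent group there is a finite
chain `{1} = C (n+1) ⊆ ⋯ ⊆ C 0 = G` of subgroups, each normal in the previous one and
convex with respect to `P`, together with nondecreasing real-valued homomorphisms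
`f_i : C i → ℝ` whose kernel is exactly `C (i+1)`. -/
theorem exists_convex_series_of_nilpotent
    {G : Type*} [Group G] [Group.FG G] [Group.IsNilpotent G]
    (P : Set G) (hP : IsPositiveCone P) :
    ∃ (n : ℕ) (C : ℕ → Subgroup G),
      C 0 = ⊤ ∧ C (n + 1) = ⊥ ∧
      ∀ i ≤ n,
        C (i + 1) ≤ C i ∧
        (∀ x ∈ C i, ∀ y ∈ C (i + 1), x⁻¹ * y * x ∈ C (i + 1)) ∧
        IsConvexIn P (C (i + 1) : Set G) ∧
        ∃ f : G → ℝ,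
          (∀ x ∈ C i, ∀ y ∈ C i, f (x * y) = f x + f y) ∧
          (∀ x ∈ C i, (f x = 0 ↔ x ∈ C (i + 1))) ∧
          (∀ x ∈ C i, ∀ y ∈ C i, x⁻¹ * y ∈ P → f x ≤ f y) := by
  obtain ⟨k, hk⟩ := exists_hasPolycyclicLength_top (G := G)
  exact hP.exists_convex_series hk fun _ _ _ _ x _ _ => Subgroup.mem_top x
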